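/- Let 𝒜 be a supersolvable line arrangement in ℙ²(ℝ) with m := m(𝒜) ≥ 3, |𝒜| = 2m, and |Sing₂(𝒜)| = m, and let Q ∈ Sing(𝒜) be a point with m(Q,𝒜) = m (hence modular). Then every line of 𝒜 not passing through Q contains exactly one simple point of 𝒜, and every other singular point of 𝒜 lying on such a line has multiplicity exactly 3. -/

import Mathlib

open scoped Classical

/-- A point of the projective plane over `K`. -/
abbrev Pt (K : Type*) [Field K] := Projectivization K (Fin 3 → K)

/-- A (candidate) line arrangement: a finite set of linear subspaces of `K³`. -/
abbrev Arr (K : Type*) [Field K] := Finset (Submodule K (Fin 3 → K))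

/-- Every member of `A` is a projective line, i.e. a 2-dimensional linear subspace of `K³`. -/
def IsLineArr {K : Type*} [Field K] (A : Arr K) : Prop :=
  ∀ L ∈ A, Module.finrank K L = 2

/-- The multiplicity `m(P, A)`: the number of lines of `A` passing through `P`. -/
noncomputable def multAt {K : Type*} [Field K] (A : Arr K) (P : Pt K) : ℕ :=
  (A.filter fun L => P.submodule ≤ L).card

/-- `Sing(A)`: the set of points lying on at least two lines of `A`. -/
def SingSet {K : Type*} [Field K] (A : Arr K) : Set (Pt K) :=
  {P | 2 ≤ multAt A P}

/-- `Sing₂(A)`: the set of simple points, i.e. singular points of multiplicity exactly 2. -/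
def Sing2Set {K : Type*} [Field K] (A : Arr K) : Set (Pt K) :=
  {P | multAt A P = 2}

/-- `m(A)`: the maximum multiplicity of a singular point of `A`. -/
noncomputable def maxMult {K : Type*} [Field K] (A : Arr K) : ℕ :=
  sSup (multAt A '' SingSet A)

/-- `P` is a modular point of `A`: it is singular, and for every other singular point `Q`
the line through `P` and `Q` belongs to `A`. -/
def IsModular {K : Type*} [Field K] (A : Arr K) (P : Pt K) : Prop :=
  P ∈ SingSet A ∧ ∀ Q ∈ SingSet A, Q ≠ P → (P.submodule ⊔ Q.submodule) ∈ A

/-- `A` is supersolvable: it has a modular point. -/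
def Supersolvable {K : Type*} [Field K] (A : Arr K) : Prop :=
  ∃ P, IsModular A P

/-- `A` has full rank (rank 3): its lines have no common point. -/
def FullRank {K : Type*} [Field K] (A : Arr K) : Prop :=
  (⨅ L ∈ A, L) = ⊥

section Incidence

variable {K : Type*} [Field K] {A : Arr K}

lemma finrank_point (P : Pt K) : Module.finrank K P.submodule = 1 := by
  rw [Projectivization.submodule_eq]
  exact finrank_span_singleton P.rep_nonzero

lemma exists_point_eq_inf {L M : Submodule K (Fin 3 → K)} (hL : Module.finrank K L = 2)
    (hM : Module.finrank K M = 2) (hLM : L ≠ M) :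
    ∃ P : Pt K, P.submodule = L ⊓ M := by
  have h := Submodule.finrank_sup_add_finrank_inf_eq L M
  have h3 : Module.finrank K (L ⊔ M : Submodule K (Fin 3 → K)) ≤ 3 := by
    simpa using Submodule.finrank_le (L ⊔ M)
  have hlt : Module.finrank K (L ⊓ M : Submodule K (Fin 3 → K)) < 2 := by
    by_contra! hge
    have h₁ : L ⊓ M = L := Submodule.eq_of_le_of_finrank_le inf_le_left (by omega)
    have h₂ : L ⊓ M = M := Submodule.eq_of_le_of_finrank_le inf_le_right (by omega)
    exact hLM (h₁.symm.trans h₂)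
  exact ⟨Projectivization.mk'' (L ⊓ M) (by omega), Projectivization.submodule_mk'' _ _⟩

lemma point_eq_of_le {L M : Submodule K (Fin 3 → K)} (hL : Module.finrank K L = 2)
    (hM : Module.finrank K M = 2) (hLM : L ≠ M) {P R : Pt K}
    (hPL : P.submodule ≤ L) (hPM : P.submodule ≤ M)
    (hRL : R.submodule ≤ L) (hRM : R.submodule ≤ M) : P = R := by
  obtain ⟨S, hS⟩ := exists_point_eq_inf hL hM hLM
  have key : ∀ T : Pt K, T.submodule ≤ L → T.submodule ≤ M → T = S := fun T hTL hTM =>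
    Projectivization.submodule_injective <| Submodule.eq_of_le_of_finrank_le
      (hS ▸ le_inf hTL hTM) (by rw [finrank_point, finrank_point])
  exact (key P hPL hPM).trans (key R hRL hRM).symm

lemma mem_singSet {L M : Submodule K (Fin 3 → K)} (hL : L ∈ A) (hM : M ∈ A) (hLM : L ≠ M)
    {P : Pt K} (hPL : P.submodule ≤ L) (hPM : P.submodule ≤ M) : P ∈ SingSet A :=
  Finset.one_lt_card.2 ⟨L, by simp [*], M, by simp [*], hLM⟩

lemma exists_meet (hA : IsLineArr A) {L M : Submodule K (Fin 3 → K)} (hL : L ∈ A) (hM : M ∈ A)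
    (hLM : L ≠ M) : ∃ P ∈ SingSet A, P.submodule ≤ L ∧ P.submodule ≤ M := by
  obtain ⟨P, hP⟩ := exists_point_eq_inf (hA L hL) (hA M hM) hLM
  have hPL : P.submodule ≤ L := hP ▸ inf_le_left
  have hPM : P.submodule ≤ M := hP ▸ inf_le_right
  exact ⟨P, mem_singSet hL hM hLM hPL hPM, hPL, hPM⟩

lemma multAt_le_maxMult {P : Pt K} (hP : P ∈ SingSet A) : multAt A P ≤ maxMult A :=
  le_csSup ⟨A.card, by rintro _ ⟨R, -, rfl⟩; exact Finset.card_filter_le _ _⟩ ⟨P, hP, rfl⟩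

lemma IsModular.exists_line {Q R : Pt K} (hQ : IsModular A Q) (hR : R ∈ SingSet A)
    (hRQ : R ≠ Q) : ∃ N ∈ A, Q.submodule ≤ N ∧ R.submodule ≤ N :=
  ⟨_, hQ.2 R hR hRQ, le_sup_left, le_sup_right⟩

/-- A point joined by lines of `A` to all singular points is modular. -/
lemma isModular_of_exists_line (hA : IsLineArr A) {Q : Pt K} (hQ : Q ∈ SingSet A)
    (h : ∀ R ∈ SingSet A, R ≠ Q → ∃ N ∈ A, Q.submodule ≤ N ∧ R.submodule ≤ N) :
    IsModular A Q := by
  refine ⟨hQ, fun R hR hRQ => ?_⟩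
  obtain ⟨N, hN, hQN, hRN⟩ := h R hR hRQ
  suffices Q.submodule ⊔ R.submodule = N by rwa [this]
  refine Submodule.eq_of_le_of_finrank_le (sup_le hQN hRN) ?_
  rw [hA N hN]
  by_contra! hlt
  have h₁ : Q.submodule = Q.submodule ⊔ R.submodule :=
    Submodule.eq_of_le_of_finrank_le le_sup_left (by rw [finrank_point]; omega)
  have h₂ : R.submodule = Q.submodule ⊔ R.submodule :=
    Submodule.eq_of_le_of_finrank_le le_sup_right (by rw [finrank_point]; omega)
  exact hRQ (Projectivization.submodule_injective (h₂.trans h₁.symm))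

/-- In a supersolvable arrangement every point of maximal multiplicity is modular. -/
lemma Supersolvable.isModular_of_multAt_eq (hA : IsLineArr A) (hss : Supersolvable A)
    {Q : Pt K} (hQ : Q ∈ SingSet A) (hQmax : multAt A Q = maxMult A) : IsModular A Q := by
  obtain ⟨M, hM⟩ := hss
  refine isModular_of_exists_line hA hQ fun R hR hRQ => ?_
  by_contra! hno
  have hRM : R ≠ M := by
    rintro rfl
    obtain ⟨N, hN, hRN, hQN⟩ := hM.exists_line hQ hRQ.symm
    exact hno N hN hQN hRN
  obtain ⟨N, hN, hMN, hRN⟩ := hM.exists_line hR hRM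
  obtain ⟨L, hL, hLN⟩ :=
    Finset.exists_mem_ne (show 1 < (A.filter fun L => R.submodule ≤ L).card from hR) N
  obtain ⟨hLA, hRL⟩ := Finset.mem_filter.1 hL
  have hQL : ¬ Q.submodule ≤ L := fun h => hno L hLA h hRL
  have hML : ¬ M.submodule ≤ L := fun h =>
    hRM (point_eq_of_le (hA L hLA) (hA N hN) hLN hRL hRN h hMN)
  have hex : ∀ X ∈ A.filter (fun X => Q.submodule ≤ X), ∃ Y ∈ A, M.submodule ≤ Y ∧
      ∃ S : Pt K, S.submodule ≤ L ∧ S.submodule ≤ X ∧ S.submodule ≤ Y := by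
    intro X hX
    obtain ⟨hXA, hQX⟩ := Finset.mem_filter.1 hX
    obtain ⟨S, hS, hSL, hSX⟩ := exists_meet hA hLA hXA (by rintro rfl; exact hQL hQX)
    obtain ⟨Y, hY, hMY, hSY⟩ := hM.exists_line hS (by rintro rfl; exact hML hSL)
    exact ⟨Y, hY, hMY, S, hSL, hSX, hSY⟩
  choose! f hfA hMf S hSL hSX hSf using hex
  have hle : (A.filter fun X => Q.submodule ≤ X).card ≤
      ((A.filter fun Y => M.submodule ≤ Y).erase N).card := by
    refine Finset.card_le_card_of_injOn f (fun X hX => ?_) fun X hX X' hX' hXX' => ?_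
    · have hXA := (Finset.mem_filter.1 hX).1
      have hQX := (Finset.mem_filter.1 hX).2
      refine Finset.mem_coe.2 (Finset.mem_erase.2 ⟨fun hfN => ?_,
        Finset.mem_filter.2 ⟨hfA X hX, hMf X hX⟩⟩)
      have hSR : S X = R := point_eq_of_le (hA L hLA) (hA N hN) hLN (hSL X hX)
        (hfN ▸ hSf X hX) hRL hRN
      exact hno X hXA hQX (hSR ▸ hSX X hX)
    · have hSS : S X = S X' := by
        refine point_eq_of_le (hA L hLA) (hA _ (hfA X hX)) ?_ (hSL X hX) (hSf X hX)
          (hSL X' hX') (hXX' ▸ hSf X' hX')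
        intro h
        exact hML (h ▸ hMf X hX)
      by_contra hne
      refine hQL ?_
      rw [point_eq_of_le (hA X (Finset.mem_filter.1 hX).1) (hA X' (Finset.mem_filter.1 hX').1) hne
        (Finset.mem_filter.1 hX).2 (Finset.mem_filter.1 hX').2 (hSX X hX)
        (hSS ▸ hSX X' hX')]
      exact hSL X hX
  have hNmem : N ∈ A.filter fun Y => M.submodule ≤ Y := Finset.mem_filter.2 ⟨hN, hMN⟩
  have hlt := Finset.card_erase_lt_of_mem hNmem
  have hMle := multAt_le_maxMult hM.1
  rw [← hQmax] at hMle
  unfold multAt at hMle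
  omega

/-- A simple point other than the modular point `Q` lies on only one line avoiding `Q`. -/
lemma IsModular.line_unique_of_simple {Q P : Pt K} (hQ : IsModular A Q) (hP : P ∈ Sing2Set A)
    (hPQ : P ≠ Q) {L L' : Submodule K (Fin 3 → K)} (hL : L ∈ A) (hL' : L' ∈ A)
    (hQL : ¬ Q.submodule ≤ L) (hQL' : ¬ Q.submodule ≤ L') (hPL : P.submodule ≤ L)
    (hPL' : P.submodule ≤ L') : L = L' := by
  by_contra hne
  have hP2 : (A.filter fun X => P.submodule ≤ X).card = 2 := hP
  obtain ⟨N, hN, hQN, hPN⟩ := hQ.exists_line (show P ∈ SingSet A from hP2.ge) hPQ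
  have : 2 < (A.filter fun X => P.submodule ≤ X).card :=
    Finset.two_lt_card.2 ⟨L, by simp [*], L', by simp [*], N, by simp [*], hne,
      by rintro rfl; exact hQL hQN, by rintro rfl; exact hQL' hQN⟩
  omega

/-- Given a modular point `Q` off the line `L ∈ A`, this maps the other lines of `A` avoiding `Q`
to the lines through `Q`, sending `X` to the line joining `Q` to `L ∩ X`. -/
lemma IsModular.exists_projection (hA : IsLineArr A) {Q : Pt K} (hQ : IsModular A Q)
    {L : Submodule K (Fin 3 → K)} (hL : L ∈ A) (hQL : ¬ Q.submodule ≤ L) :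
    ∃ f : Submodule K (Fin 3 → K) → Submodule K (Fin 3 → K),
      (∀ X ∈ (A.filter fun X => ¬ Q.submodule ≤ X).erase L,
        f X ∈ A.filter fun X => Q.submodule ≤ X) ∧
      ∀ X ∈ (A.filter fun X => ¬ Q.submodule ≤ X).erase L, ∀ N ∈ A, Q.submodule ≤ N →
        ∀ P : Pt K, P.submodule ≤ L → P.submodule ≤ N → (f X = N ↔ P.submodule ≤ X) := by
  have hex : ∀ X ∈ (A.filter fun X => ¬ Q.submodule ≤ X).erase L,
      ∃ Y ∈ A.filter (fun X => Q.submodule ≤ X), ∃ S : Pt K,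
        S.submodule ≤ L ∧ S.submodule ≤ X ∧ S.submodule ≤ Y := by
    intro X hX
    obtain ⟨hXL, hX⟩ := Finset.mem_erase.1 hX
    obtain ⟨S, hS, hSL, hSX⟩ := exists_meet hA hL (Finset.mem_filter.1 hX).1 hXL.symm
    obtain ⟨Y, hY, hQY, hSY⟩ := hQ.exists_line hS (by rintro rfl; exact hQL hSL)
    exact ⟨Y, Finset.mem_filter.2 ⟨hY, hQY⟩, S, hSL, hSX, hSY⟩
  choose! f hf S hSL hSX hSf using hex
  refine ⟨f, hf, fun X hX N hN hQN P hPL hPN => ⟨fun h => ?_, fun hPX => ?_⟩⟩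
  · rw [point_eq_of_le (hA L hL) (hA N hN) (by rintro rfl; exact hQL hQN) hPL hPN (hSL X hX)
      (h ▸ hSf X hX)]
    exact hSX X hX
  · obtain ⟨hXL, hXB⟩ := Finset.mem_erase.1 hX
    have hPS : P = S X := point_eq_of_le (hA L hL) (hA X (Finset.mem_filter.1 hXB).1) hXL.symm
      hPL hPX (hSL X hX) (hSX X hX)
    by_contra hne
    have hfX := Finset.mem_filter.1 (hf X hX)
    have hPQ : P = Q := point_eq_of_le (hA _ hfX.1) (hA N hN) hne (hPS ▸ hSf X hX) hPN
      hfX.2 hQN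
    exact hQL (hPQ ▸ hPL)

/-- The lines through a point `P ≠ Q` on `L` and on a line `N` through `Q` are `L`, `N`, and lines
avoiding `Q`. -/
lemma mem_of_le_of_ne (hA : IsLineArr A) {Q P : Pt K} {L N X : Submodule K (Fin 3 → K)}
    (hQL : ¬ Q.submodule ≤ L) (hN : N ∈ A) (hQN : Q.submodule ≤ N) (hPL : P.submodule ≤ L)
    (hPN : P.submodule ≤ N) (hX : X ∈ A) (hPX : P.submodule ≤ X) (hXL : X ≠ L) (hXN : X ≠ N) :
    X ∈ (A.filter fun X => ¬ Q.submodule ≤ X).erase L := by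
  refine Finset.mem_erase.2 ⟨hXL, Finset.mem_filter.2 ⟨hX, fun hQX => hQL ?_⟩⟩
  rwa [point_eq_of_le (hA X hX) (hA N hN) hXN hQX hQN hPX hPN]

/-- If a modular point `Q` off `L ∈ A` lies on at least half of the lines of `A`, then `L` contains
a simple point. -/
lemma IsModular.exists_simple (hA : IsLineArr A) {Q : Pt K} (hQ : IsModular A Q)
    (hcard : A.card ≤ 2 * multAt A Q)
    {L : Submodule K (Fin 3 → K)} (hL : L ∈ A) (hQL : ¬ Q.submodule ≤ L) :
    ∃ P ∈ Sing2Set A, P.submodule ≤ L := by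
  obtain ⟨f, hf, hfN⟩ := hQ.exists_projection hA hL hQL
  have hsum := Finset.card_filter_add_card_filter_not (s := A) (fun X => Q.submodule ≤ X)
  have hLB : L ∈ A.filter fun X => ¬ Q.submodule ≤ X := Finset.mem_filter.2 ⟨hL, hQL⟩
  have herase := Finset.card_erase_lt_of_mem hLB
  unfold multAt at hcard
  obtain ⟨N, hN, hNf⟩ := Finset.exists_mem_notMem_of_card_lt_card
    (s := ((A.filter fun X => ¬ Q.submodule ≤ X).erase L).image f)
    (t := A.filter fun X => Q.submodule ≤ X)
    (Finset.card_image_le.trans_lt (by omega))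
  obtain ⟨hNA, hQN⟩ := Finset.mem_filter.1 hN
  have hLN : L ≠ N := by rintro rfl; exact hQL hQN
  obtain ⟨P, hP, hPL, hPN⟩ := exists_meet hA hL hNA hLN
  refine ⟨P, ?_, hPL⟩
  have : (A.filter fun X => P.submodule ≤ X) = {L, N} := by
    ext X
    simp only [Finset.mem_filter, Finset.mem_insert, Finset.mem_singleton]
    constructor
    · rintro ⟨hX, hPX⟩
      by_contra! hne
      have hXB := mem_of_le_of_ne hA hQL hNA hQN hPL hPN hX hPX hne.1 hne.2
      exact hNf (Finset.mem_image.2 ⟨X, hXB, (hfN X hXB N hNA hQN P hPL hPN).2 hPX⟩)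
    · rintro (rfl | rfl)
      exacts [⟨hL, hPL⟩, ⟨hNA, hPN⟩]
  change (A.filter fun X => P.submodule ≤ X).card = 2
  rw [this, Finset.card_pair hLN]

/-- If `L` contains a unique simple point and the modular point `Q` off `L` lies on at least half
of the lines of `A`, then the other singular points on `L` are triple points. -/
lemma IsModular.multAt_eq_three (hA : IsLineArr A) {Q : Pt K} (hQ : IsModular A Q)
    (hcard : A.card ≤ 2 * multAt A Q)
    {L : Submodule K (Fin 3 → K)} (hL : L ∈ A) (hQL : ¬ Q.submodule ≤ L)
    {P₀ : Pt K} (hP₀ : P₀ ∈ Sing2Set A) (hP₀L : P₀.submodule ≤ L)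
    (huniq : ∀ P ∈ Sing2Set A, P.submodule ≤ L → P = P₀)
    {P : Pt K} (hP : P ∈ SingSet A) (hPL : P.submodule ≤ L) (hP2 : P ∉ Sing2Set A) :
    multAt A P = 3 := by
  obtain ⟨f, hf, hfN⟩ := hQ.exists_projection hA hL hQL
  have hsum := Finset.card_filter_add_card_filter_not (s := A) (fun X => Q.submodule ≤ X)
  have hLB : L ∈ A.filter fun X => ¬ Q.submodule ≤ X := Finset.mem_filter.2 ⟨hL, hQL⟩
  have herase := Finset.card_erase_of_mem hLB
  unfold multAt at hcard
  obtain ⟨N₀, hN₀, hQN₀, hP₀N₀⟩ := hQ.exists_line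
    (show P₀ ∈ SingSet A from (show multAt A P₀ = 2 from hP₀).ge)
    (by rintro rfl; exact hQL hP₀L)
  have hN₀mem : N₀ ∈ A.filter fun X => Q.submodule ≤ X := Finset.mem_filter.2 ⟨hN₀, hQN₀⟩
  have herase' := Finset.card_erase_of_mem hN₀mem
  have hsurj : (A.filter fun X => Q.submodule ≤ X).erase N₀ ⊆
      ((A.filter fun X => ¬ Q.submodule ≤ X).erase L).image f := by
    intro N hN
    obtain ⟨hNN₀, hN⟩ := Finset.mem_erase.1 hN
    obtain ⟨hNA, hQN⟩ := Finset.mem_filter.1 hN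
    have hLN : L ≠ N := by rintro rfl; exact hQL hQN
    obtain ⟨R, hR, hRL, hRN⟩ := exists_meet hA hL hNA hLN
    have hR2 : R ∉ Sing2Set A := fun h => hQL <| by
      rw [point_eq_of_le (hA N hNA) (hA N₀ hN₀) hNN₀ hQN hQN₀ hRN (huniq R h hRL ▸ hP₀N₀)]
      exact hRL
    have hlt : 2 < (A.filter fun X => R.submodule ≤ X).card :=
      lt_of_le_of_ne hR fun h => hR2 h.symm
    obtain ⟨X, hX, hXn⟩ := Finset.exists_mem_notMem_of_card_lt_card
      (s := {L, N}) (Finset.card_le_two.trans_lt hlt)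
    obtain ⟨hXA, hRX⟩ := Finset.mem_filter.1 hX
    simp only [Finset.mem_insert, Finset.mem_singleton, not_or] at hXn
    have hXB := mem_of_le_of_ne hA hQL hNA hQN hRL hRN hXA hRX hXn.1 hXn.2
    exact Finset.mem_image.2 ⟨X, hXB, (hfN X hXB N hNA hQN R hRL hRN).2 hRX⟩
  have hinj : Set.InjOn f ((A.filter fun X => ¬ Q.submodule ≤ X).erase L) := by
    refine Finset.card_image_iff.1 (le_antisymm Finset.card_image_le ?_)
    have := Finset.card_le_card hsurj
    omega
  obtain ⟨N, hN, hQN, hPN⟩ := hQ.exists_line hP (by rintro rfl; exact hQL hPL)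
  have hLN : L ≠ N := by rintro rfl; exact hQL hQN
  have hge : 2 < multAt A P := lt_of_le_of_ne hP fun h => hP2 h.symm
  refine le_antisymm ?_ hge
  have hLmem : L ∈ A.filter fun X => P.submodule ≤ X := Finset.mem_filter.2 ⟨hL, hPL⟩
  have hNmem : N ∈ (A.filter fun X => P.submodule ≤ X).erase L :=
    Finset.mem_erase.2 ⟨hLN.symm, Finset.mem_filter.2 ⟨hN, hPN⟩⟩
  have hone : (((A.filter fun X => P.submodule ≤ X).erase L).erase N).card ≤ 1 := by
    have key : ∀ X ∈ ((A.filter fun X => P.submodule ≤ X).erase L).erase N,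
        X ∈ (A.filter fun X => ¬ Q.submodule ≤ X).erase L ∧ f X = N := by
      intro X hX
      simp only [Finset.mem_erase, Finset.mem_filter] at hX
      obtain ⟨hXN, hXL, hXA, hPX⟩ := hX
      have hXB := mem_of_le_of_ne hA hQL hN hQN hPL hPN hXA hPX hXL hXN
      exact ⟨hXB, (hfN X hXB N hN hQN P hPL hPN).2 hPX⟩
    exact Finset.card_le_one.2 fun X hX Y hY =>
      hinj (key X hX).1 (key Y hY).1 ((key X hX).2.trans (key Y hY).2.symm)
  rw [Finset.card_erase_of_mem hNmem, Finset.card_erase_of_mem hLmem] at hone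
  unfold multAt
  omega

end Incidence

/-- If `A` is a real supersolvable arrangement with `m := m(A) ≥ 3`,
`|A| = 2m` and `|Sing₂(A)| = m`, and `Q` is a singular point of multiplicity `m`, then every
line of `A` not passing through `Q` contains exactly one simple point, and every other
singular point on such a line has multiplicity exactly 3. -/
theorem extremal_lines_off_modular (A : Arr ℝ) (hA : IsLineArr A) (hss : Supersolvable A)
    (hm : 3 ≤ maxMult A) (hcard : A.card = 2 * maxMult A)
    (hs2 : (Sing2Set A).ncard = maxMult A)
    (Q : Pt ℝ) (hQ : Q ∈ SingSet A) (hQmax : multAt A Q = maxMult A) :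
    ∀ L ∈ A, ¬ Q.submodule ≤ L →
      (∃! P : Pt ℝ, P ∈ Sing2Set A ∧ P.submodule ≤ L) ∧
      (∀ P ∈ SingSet A, P.submodule ≤ L → P ∉ Sing2Set A → multAt A P = 3) := by
  have hQmod := hss.isModular_of_multAt_eq hA hQ hQmax
  have hcard' : A.card ≤ 2 * multAt A Q := by omega
  have hfin : (Sing2Set A).Finite := Set.finite_of_ncard_ne_zero (by omega)
  have hQ2 : Q ∉ Sing2Set A := fun h => by
    have : multAt A Q = 2 := h
    omega
  have hex : ∀ L ∈ A.filter (fun X => ¬ Q.submodule ≤ X),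
      ∃ P ∈ Sing2Set A, P.submodule ≤ L := fun L hL =>
    hQmod.exists_simple hA hcard' (Finset.mem_filter.1 hL).1 (Finset.mem_filter.1 hL).2
  choose! g hg2 hgL using hex
  have hginj : Set.InjOn g (A.filter fun X => ¬ Q.submodule ≤ X) := by
    intro L hL L' hL' h
    obtain ⟨hLA, hQL⟩ := Finset.mem_filter.1 hL
    obtain ⟨hLA', hQL'⟩ := Finset.mem_filter.1 hL'
    exact hQmod.line_unique_of_simple (hg2 L hL) (fun h => hQ2 (h ▸ hg2 L hL)) hLA hLA' hQL hQL'
      (hgL L hL) (h ▸ hgL L' hL')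
  have hsum := Finset.card_filter_add_card_filter_not (s := A) (fun X => Q.submodule ≤ X)
  have himage : g '' (A.filter fun X => ¬ Q.submodule ≤ X) = Sing2Set A := by
    refine Set.eq_of_subset_of_ncard_le (Set.image_subset_iff.2 hg2) ?_ hfin
    rw [hginj.ncard_image, Set.ncard_coe_finset]
    unfold multAt at hQmax
    omega
  intro L hL hQL
  have hLB : L ∈ A.filter fun X => ¬ Q.submodule ≤ X := Finset.mem_filter.2 ⟨hL, hQL⟩
  have huniq : ∀ P ∈ Sing2Set A, P.submodule ≤ L → P = g L := by
    intro P hP hPL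
    obtain ⟨L', hL', rfl⟩ := himage.symm ▸ hP
    obtain ⟨hLA', hQL'⟩ := Finset.mem_filter.1 hL'
    rw [hQmod.line_unique_of_simple hP (fun h => hQ2 (h ▸ hP)) hL hLA' hQL hQL' hPL (hgL L' hL')]
  exact ⟨⟨g L, ⟨hg2 L hLB, hgL L hLB⟩, fun P hP => huniq P hP.1 hP.2⟩, fun P hP hPL hP2 =>
    hQmod.multAt_eq_three hA hcard' hL hQL (hg2 L hLB) (hgL L hLB) huniq hP hPL hP2⟩
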